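/- arXiv:2303.15608 — 13 statements merged into one kernel-verified Lean document; each statement's English description precedes it below -/
import Mathlib

section
/- For every p in the interval (0, (2-√2)/4], let g₀(p) = (√2+1 - (√2+2)p)/(1-2p²). Then 2 ≤ g₀(p) < 1/p, and f_p^det(g₀(p)) = 2(2+√2), where f_p^det(g) := (1 - g(2g(p-2)p + g + 2))/((1-g)(1-gp)). -/
/-- Competitive ratio of the deterministic faulty linear search algorithm with
expansion factor `g` and turn-failure probability `p`. -/
noncomputable def fdet (p g : ℝ) : ℝ :=
  (1 - g * (2 * g * (p - 2) * p + g + 2)) / ((1 - g) * (1 - g * p))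

theorem stmt0 (p : ℝ) (hp0 : 0 < p) (hp1 : p ≤ (2 - Real.sqrt 2) / 4) :
    2 ≤ (Real.sqrt 2 + 1 - (Real.sqrt 2 + 2) * p) / (1 - 2 * p ^ 2) ∧
    (Real.sqrt 2 + 1 - (Real.sqrt 2 + 2) * p) / (1 - 2 * p ^ 2) < 1 / p ∧
    fdet p ((Real.sqrt 2 + 1 - (Real.sqrt 2 + 2) * p) / (1 - 2 * p ^ 2)) =
      2 * (2 + Real.sqrt 2) := by
  have h2 : Real.sqrt 2 ^ 2 = 2 := Real.sq_sqrt (by norm_num)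
  have hs0 : 1.4 < Real.sqrt 2 := Real.lt_sqrt_of_sq_lt (by norm_num)
  have hs1 : Real.sqrt 2 < 1.5 := by
    rw [Real.sqrt_lt' (by norm_num)]; norm_num
  generalize Real.sqrt 2 = s at *
  norm_num at hs0 hs1
  have hp2 : p < 1 / 5 := by linarith
  have ha : 0 < 1 - s * p := by nlinarith
  have hb : 0 < 1 + s * p := by nlinarith
  have hg : (s + 1 - (s + 2) * p) / (1 - 2 * p ^ 2) = (s + 1) / (1 + s * p) := by
    rw [div_eq_div_iff (by nlinarith) hb.ne']
    linear_combination (p - p ^ 2) * h2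
  rw [hg]
  refine ⟨?_, ?_, ?_⟩
  · rw [le_div_iff₀ hb]
    nlinarith
  · rw [div_lt_div_iff₀ hb hp0]
    nlinarith
  · have e1 : 1 - (s + 1) / (1 + s * p) = -(s * (1 - p)) / (1 + s * p) := by
      field_simp; ring
    have e2 : 1 - (s + 1) / (1 + s * p) * p = (1 - p) / (1 + s * p) := by
      field_simp; ring
    unfold fdet
    rw [e1, e2]
    have hq : 1 - p ≠ 0 := by linarith
    have hs : s ≠ 0 := by linarith
    field_simp
    ring_nf
    have h3 : s ^ 3 = 2 * s := by linear_combination s * h2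
    have h4 : s ^ 4 = 4 := by linear_combination (s ^ 2 + 2) * h2
    simp only [h2, h3, h4]
    ring
end

section
/- For every p in the interval (0, (2-√2)/4] and every real g with 2 ≤ g < 1/p, one has f_p^det(g) ≥ 2(2+√2), where f_p^det(g) := (1 - g(2g(p-2)p + g + 2))/((1-g)(1-gp)). -/
theorem stmt1 (p : ℝ) (hp0 : 0 < p) (hp1 : p ≤ (2 - Real.sqrt 2) / 4)
    (g : ℝ) (hg2 : 2 ≤ g) (hgp : g < 1 / p) :
    fdet p g ≥ 2 * (2 + Real.sqrt 2) := by
  have hs : Real.sqrt 2 * Real.sqrt 2 = 2 := Real.mul_self_sqrt (by norm_num)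
  have h1 : g * p < 1 := (lt_div_iff₀ hp0).mp hgp
  have hD : 0 < (g - 1) * (1 - g * p) := mul_pos (by linarith) (by linarith)
  have hE : (1 - g) * (1 - g * p) < 0 := by nlinarith
  unfold fdet
  rw [ge_iff_le, le_div_iff_of_neg hE]
  generalize Real.sqrt 2 = s at hs
  have key : 2 * (2 + s) * ((1 - g) * (1 - g * p))
      - (1 - g * (2 * g * (p - 2) * p + g + 2)) = (g * (1 + s * p) - (1 + s)) ^ 2 := by
    linear_combination (-(g * p - 1) ^ 2) * hs
  nlinarith [sq_nonneg (g * (1 + s * p) - (1 + s))]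
end

section
/- For every p in the interval [(2-√2)/4, 1/2) and every real g with 2 ≤ g < 1/p, one has f_p^det(g) ≥ f_p^det(2) = 6 - 4p + 1/(1-2p), where f_p^det(g) := (1 - g(2g(p-2)p + g + 2))/((1-g)(1-gp)). -/
theorem stmt2 (p : ℝ) (hp0 : (2 - Real.sqrt 2) / 4 ≤ p) (hp1 : p < 1 / 2)
    (g : ℝ) (hg2 : 2 ≤ g) (hgp : g < 1 / p) :
    fdet p g ≥ fdet p 2 ∧ fdet p 2 = 6 - 4 * p + 1 / (1 - 2 * p) := by
  have hs : Real.sqrt 2 ^ 2 = 2 := Real.sq_sqrt (by norm_num)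
  have hs0 : 0 ≤ Real.sqrt 2 := Real.sqrt_nonneg 2
  have hs2 : Real.sqrt 2 < 2 := by nlinarith
  have hp : 0 < p := by linarith
  have hgp' : g * p < 1 := (lt_div_iff₀ hp).mp hgp
  have hq : 0 < 1 - 2 * p := by linarith
  have hd : 0 < 1 - g * p := by linarith
  have hg : 0 < g - 1 := by linarith
  have hquad : 0 ≤ -8 * p ^ 2 + 8 * p - 1 := by
    nlinarith [mul_nonneg (sub_nonneg.mpr hp0)
      (by linarith : 0 ≤ (2 + Real.sqrt 2) / 4 - p)]
  have ha : 0 ≤ 1 + 2 * p - 4 * p ^ 2 := by nlinarith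
  have h2 : fdet p 2 = (8 * p ^ 2 - 16 * p + 7) / (1 - 2 * p) := by
    unfold fdet
    rw [div_eq_div_iff (by nlinarith) hq.ne']
    ring
  have h1 : fdet p g = (g ^ 2 * (2 * p ^ 2 - 4 * p + 1) + 2 * g - 1) /
      ((g - 1) * (1 - g * p)) := by
    unfold fdet
    rw [div_eq_div_iff (by nlinarith [mul_pos hg hd]) (mul_pos hg hd).ne']
    ring
  constructor
  · rw [h1, h2, ge_iff_le, div_le_div_iff₀ hq (mul_pos hg hd)]
    have hlin : 0 ≤ (1 + 2 * p - 4 * p ^ 2) * g - (3 - 4 * p) := by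
      nlinarith [mul_nonneg ha (sub_nonneg.mpr hg2)]
    have := mul_nonneg (mul_nonneg (sub_nonneg.mpr hg2) (by linarith : 0 ≤ 1 - p)) hlin
    linarith
  · rw [h2]
    have hq1 : 1 - 2 * p ≠ 0 := hq.ne'
    rw [div_eq_iff hq1, add_mul, one_div, inv_mul_cancel₀ hq1]
    ring
end

section
/- Fix p in (0, 1/2), g in [2, 1/p), a natural number t, and a real n with g^t < n ≤ g^{t+1}. Define R₀ := ((1-p)·g^{t+1}·(1 + (1-2p)·(g + (g-1)·(2p-1)^t)))/((g-1)(1-gp)) - 2(1-p)/(g-1) + n. Then R₀/n ≤ ((1-p)g/(1-gp)) · ((1 + (1-2p)g)/(g-1) + (1-2p)^{t+1}) + 1. -/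
theorem stmt5 (p : ℝ) (hp0 : 0 < p) (hp1 : p < 1 / 2)
    (g : ℝ) (hg2 : 2 ≤ g) (hgp : g < 1 / p)
    (t : ℕ) (n : ℝ) (hn1 : g ^ t < n) (hn2 : n ≤ g ^ (t + 1)) :
    (((1 - p) * g ^ (t + 1) * (1 + (1 - 2 * p) * (g + (g - 1) * (2 * p - 1) ^ t))) /
        ((g - 1) * (1 - g * p)) - 2 * (1 - p) / (g - 1) + n) / n ≤
      (1 - p) * g / (1 - g * p) *
        ((1 + (1 - 2 * p) * g) / (g - 1) + (1 - 2 * p) ^ (t + 1)) + 1 := by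
  have hd : 0 < 1 - g * p := by
    have := (lt_div_iff₀ hp0).1 hgp
    linarith
  have hg1 : 0 < g - 1 := by linarith
  have hg0 : 0 < g := by linarith
  have hq : 0 < 1 - 2 * p := by linarith
  have hp : 0 < 1 - p := by linarith
  have hgt : 0 < g ^ t := pow_pos hg0 t
  have hn : 0 < n := hgt.trans hn1
  have hpow : (2 * p - 1) ^ t ≤ (1 - 2 * p) ^ t := by
    have h := le_abs_self ((2 * p - 1) ^ t)
    rwa [abs_pow, abs_sub_comm, abs_of_pos hq] at h
  have hC : 0 < (1 - p) * g / (1 - g * p) := by positivity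
  have hB : 0 ≤ (1 - p) * g / (1 - g * p) *
        ((1 + (1 - 2 * p) * g) / (g - 1) + (1 - 2 * p) ^ (t + 1)) := by positivity
  have hE : ((1 - p) * g ^ (t + 1) * (1 + (1 - 2 * p) * (g + (g - 1) * (2 * p - 1) ^ t))) /
        ((g - 1) * (1 - g * p)) = g ^ t * ((1 - p) * g / (1 - g * p) *
        ((1 + (1 - 2 * p) * g) / (g - 1) + (1 - 2 * p) * (2 * p - 1) ^ t)) := by
    generalize (2 * p - 1) ^ t = x
    rw [pow_succ]
    generalize g ^ t = y
    have h1 := hd.ne'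
    have h2 := hg1.ne'
    rw [div_add' _ _ _ h2, div_mul_div_comm, ← mul_div_assoc, mul_comm (1 - g * p)]
    congr 1
    ring
  have hle : g ^ t * ((1 - p) * g / (1 - g * p) *
        ((1 + (1 - 2 * p) * g) / (g - 1) + (1 - 2 * p) * (2 * p - 1) ^ t)) ≤
      g ^ t * ((1 - p) * g / (1 - g * p) *
        ((1 + (1 - 2 * p) * g) / (g - 1) + (1 - 2 * p) ^ (t + 1))) := by
    rw [pow_succ' (1 - 2 * p)]
    gcongr
  have h3 := mul_le_mul_of_nonneg_right hn1.le hB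
  have h4 : 0 ≤ 2 * (1 - p) / (g - 1) := by positivity
  rw [div_le_iff₀ hn, hE]
  linarith
end

section
/- Let p_0 := (5 - √(1 + (ln 2)² + 6·ln 2) - ln 2)/8 and, for real p and g > 0, let h_p(g) := (1-gp)(1 + g(1-2p)) - g(1-p)·ln g. Then for every p in [0, p_0] there exists a unique g in the interval [2, 4) with h_p(g) = 0. -/
/-- The function whose root determines the optimal expansion factor of the
randomized faulty linear search algorithm with turn-failure probability `p`. -/
noncomputable def hfun (p g : ℝ) : ℝ :=
  (1 - g * p) * (1 + g * (1 - 2 * p)) - g * (1 - p) * Real.log g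

/-- The threshold probability `p₀ ≈ 0.241516`. -/
noncomputable def p₀ : ℝ :=
  (5 - Real.sqrt (1 + (Real.log 2) ^ 2 + 6 * Real.log 2) - Real.log 2) / 8

theorem hfun_aux (p a b : ℝ) (h0 : 0 ≤ p) (h1 : p ≤ 1 / 4) (ha : 0 < a) (hab : a < b) :
    hfun p b * a < hfun p a * b := by
  have hl : Real.log a < Real.log b := Real.log_lt_log ha hab
  have hb : 0 < b := ha.trans hab
  have e : hfun p a * b - hfun p b * a = (b - a) + p * (1 - 2 * p) * (a * b) * (b - a)
      + a * b * (1 - p) * (Real.log b - Real.log a) := by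
    unfold hfun; ring
  have t1 : 0 ≤ p * (1 - 2 * p) * (a * b) * (b - a) :=
    mul_nonneg (mul_nonneg (mul_nonneg h0 (by linarith)) (by positivity)) (by linarith)
  have t2 : 0 ≤ a * b * (1 - p) * (Real.log b - Real.log a) :=
    mul_nonneg (mul_nonneg (by positivity) (by linarith)) (by linarith)
  linarith

theorem stmt6 (p : ℝ) (hp : p ∈ Set.Icc 0 p₀) :
    ∃! g, g ∈ Set.Ico (2 : ℝ) 4 ∧ hfun p g = 0 := by
  obtain ⟨h0, hp1⟩ := hp
  have hL1 := Real.log_two_gt_d9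
  have hL2 := Real.log_two_lt_d9
  unfold p₀ at hp1
  have hs0 := Real.sqrt_nonneg (1 + (Real.log 2) ^ 2 + 6 * Real.log 2)
  have hs := Real.sq_sqrt (show 0 ≤ 1 + (Real.log 2) ^ 2 + 6 * Real.log 2 by positivity)
  have hs3 : 3 - Real.log 2 ≤ √(1 + (Real.log 2) ^ 2 + 6 * Real.log 2) := by
    apply Real.le_sqrt_of_sq_le
    nlinarith
  generalize √(1 + (Real.log 2) ^ 2 + 6 * Real.log 2) = s at *
  have h1 : p ≤ 1 / 4 := by linarith
  have H2 : 0 ≤ hfun p 2 := by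
    have e : 8 * hfun p 2 = (5 - s - Real.log 2 - 8 * p) * (5 + s - Real.log 2 - 8 * p) := by
      unfold hfun; linear_combination hs
    have : 0 ≤ (5 - s - Real.log 2 - 8 * p) * (5 + s - Real.log 2 - 8 * p) :=
      mul_nonneg (by linarith) (by linarith)
    linarith
  have H4 : hfun p 4 < 0 := by
    have e : Real.log 4 = 2 * Real.log 2 := by
      rw [show (4 : ℝ) = 2 ^ 2 by norm_num, Real.log_pow]; norm_num
    unfold hfun
    rw [e]
    nlinarith [mul_nonneg h0 (sub_nonneg.2 h1), mul_nonneg h0 (sub_nonneg.2 hL2.le)]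
  have hc : ContinuousOn (hfun p) (Set.Icc 2 4) := by
    unfold hfun
    apply ContinuousOn.sub (by fun_prop)
    apply ContinuousOn.mul (by fun_prop)
    apply Real.continuousOn_log.mono
    intro x hx
    have := hx.1
    simp only [Set.mem_compl_iff, Set.mem_singleton_iff]
    linarith
  obtain ⟨g, hg, hg0⟩ := intermediate_value_Icc' (by norm_num) hc ⟨H4.le, H2⟩
  refine ⟨g, ⟨⟨hg.1, lt_of_le_of_ne hg.2 ?_⟩, hg0⟩, ?_⟩
  · rintro rfl
    linarith
  · rintro y ⟨hy, hy0⟩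
    rcases lt_trichotomy y g with h | h | h
    · have := hfun_aux p y g h0 h1 (by linarith [hy.1]) h
      rw [hg0, hy0] at this
      linarith
    · exact h
    · have := hfun_aux p g y h0 h1 (by linarith [hg.1]) h
      rw [hg0, hy0] at this
      linarith
end

section
/- For every p in [0, 1/2], the function g ↦ h_p(g) := (1-gp)(1 + g(1-2p)) - g(1-p)·ln g is strictly decreasing on the interval [2, ∞); in particular its derivative with respect to g, which equals 4gp² - 2gp + (p-1)·ln g - 2p, is negative for all g ≥ 2. -/
theorem stmt7 (p : ℝ) (hp : p ∈ Set.Icc (0 : ℝ) (1 / 2)) :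
    StrictAntiOn (fun g => hfun p g) (Set.Ici 2) ∧
    ∀ g : ℝ, 2 ≤ g →
      HasDerivAt (fun g => hfun p g)
        (4 * g * p ^ 2 - 2 * g * p + (p - 1) * Real.log g - 2 * p) g ∧
      4 * g * p ^ 2 - 2 * g * p + (p - 1) * Real.log g - 2 * p < 0 := by
  obtain ⟨h0, h1⟩ := hp
  have key : ∀ g : ℝ, 2 ≤ g →
      HasDerivAt (fun g => hfun p g)
        (4 * g * p ^ 2 - 2 * g * p + (p - 1) * Real.log g - 2 * p) g ∧
      4 * g * p ^ 2 - 2 * g * p + (p - 1) * Real.log g - 2 * p < 0 := by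
    intro g hg
    have hg0 : g ≠ 0 := by linarith
    constructor
    · have d1 : HasDerivAt (fun g : ℝ => 1 - g * p) (-(1 * p)) g :=
        ((hasDerivAt_id' g).mul_const p).const_sub 1
      have d2 : HasDerivAt (fun g : ℝ => 1 + g * (1 - 2 * p)) (1 * (1 - 2 * p)) g :=
        ((hasDerivAt_id' g).mul_const (1 - 2 * p)).const_add 1
      have d3 : HasDerivAt (fun g : ℝ => g * (1 - p)) (1 * (1 - p)) g :=
        (hasDerivAt_id' g).mul_const (1 - p)
      have d := (d1.fun_mul d2).fun_sub (d3.fun_mul (Real.hasDerivAt_log hg0))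
      unfold hfun
      refine d.congr_deriv ?_
      field_simp
      ring
    · have hl : 0 < Real.log g := Real.log_pos (by linarith)
      have a : 0 ≤ (g * p) * (1 - 2 * p) :=
        mul_nonneg (mul_nonneg (by linarith) h0) (by linarith)
      have b : 0 < (1 - p) * Real.log g := mul_pos (by linarith) hl
      nlinarith
  refine ⟨?_, key⟩
  apply strictAntiOn_of_deriv_neg (convex_Ici 2)
  · intro g hg
    exact (key g hg).1.continuousAt.continuousWithinAt
  · intro g hg
    rw [interior_Ici] at hg
    have hk := key g (le_of_lt hg)
    rw [hk.1.deriv]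
    exact hk.2
end

section
/- Let p_0 := (5 - √(1 + (ln 2)² + 6·ln 2) - ln 2)/8. For every p in [p_0, 1/2) and every real g with 2 ≤ g < 1/p, one has f_p^rand(g) ≥ f_p^rand(2) = 1 + (1-p)(3-4p)/((1-2p)·ln 2), where f_p^rand(g) := 1 + (1-p)(1 + g(1-2p))/((1-gp)·ln g). -/
/-- Competitive ratio of the randomized faulty linear search algorithm with
expansion factor `g` and turn-failure probability `p`. -/
noncomputable def frand (p g : ℝ) : ℝ :=
  1 + (1 - p) * (1 + g * (1 - 2 * p)) / ((1 - g * p) * Real.log g)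

theorem stmt9 (p : ℝ) (hp0 : p₀ ≤ p) (hp1 : p < 1 / 2)
    (g : ℝ) (hg2 : 2 ≤ g) (hgp : g < 1 / p) :
    frand p g ≥ frand p 2 ∧
    frand p 2 = 1 + (1 - p) * (3 - 4 * p) / ((1 - 2 * p) * Real.log 2) := by
  have h2 : frand p 2 = 1 + (1 - p) * (3 - 4 * p) / ((1 - 2 * p) * Real.log 2) := by
    unfold frand
    congr 2
    ring
  refine ⟨?_, h2⟩
  rw [h2]
  unfold frand
  unfold p₀ at hp0
  have hL1 : Real.log 2 < 1 := by linarith [Real.log_two_lt_d9]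
  have hL0 : 0 < Real.log 2 := Real.log_pos (by norm_num)
  have hlog : Real.log g ≤ Real.log 2 + (g - 2) / 2 := by
    have h := Real.log_le_sub_one_of_pos (show 0 < g / 2 by linarith)
    rw [Real.log_div (by linarith) (by norm_num)] at h
    linarith
  have hlg : 0 < Real.log g := Real.log_pos (by linarith)
  generalize Real.log g = M at *
  generalize Real.log 2 = L at *
  have hs0 := Real.sqrt_nonneg (1 + L ^ 2 + 6 * L)
  have hs := Real.sq_sqrt (show 0 ≤ 1 + L ^ 2 + 6 * L by positivity)
  generalize Real.sqrt (1 + L ^ 2 + 6 * L) = s at *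
  have hp : 0 < p := by
    have : s < 5 - L := by nlinarith
    linarith
  have hgp' : 0 < 1 - g * p := by
    rw [lt_div_iff₀ hp] at hgp; linarith
  have hq : (3 - 4 * p) * (1 - 2 * p) ≤ 2 * L * (1 - p) := by
    have h1 : 5 - L - 8 * p ≤ s := by linarith
    have h3 : 0 ≤ 5 - L - 8 * p := by linarith
    nlinarith [mul_self_le_mul_self h3 h1]
  have hk : (3 - 4 * p) * (1 - g * p) ≤ 2 * L * (1 - p) := by
    have : (3 - 4 * p) * (1 - g * p) ≤ (3 - 4 * p) * (1 - 2 * p) := by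
      apply mul_le_mul_of_nonneg_left _ (by linarith)
      nlinarith
    linarith
  have key : (3 - 4 * p) * ((1 - g * p) * M) ≤ (1 + g * (1 - 2 * p)) * ((1 - 2 * p) * L) := by
    have a := mul_le_mul_of_nonneg_left hlog
      (mul_nonneg (show 0 ≤ 3 - 4 * p by linarith) hgp'.le)
    have b := mul_le_mul_of_nonneg_right hk (show 0 ≤ (g - 2) / 2 by linarith)
    linarith
  have hd : 0 < (1 - 2 * p) * L := mul_pos (by linarith) hL0
  have := (div_le_div_iff₀ hd (mul_pos hgp' hlg)).2 key
  have := mul_le_mul_of_nonneg_left this (show 0 ≤ 1 - p by linarith)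
  rw [mul_div_assoc, mul_div_assoc]
  linarith
end

section
/- Let p_0 := (5 - √(1 + (ln 2)² + 6·ln 2) - ln 2)/8 and h_p(g) := (1-gp)(1 + g(1-2p)) - g(1-p)·ln g. For every p in (0, p_0], if g* ∈ [2, 4) satisfies h_p(g*) = 0, then f_p^rand(g*) = g*·((1-p)/(1-g*p))² + 1, and for every g with 2 ≤ g < 1/p one has f_p^rand(g) ≥ g*·((1-p)/(1-g*p))² + 1, where f_p^rand(g) := 1 + (1-p)(1 + g(1-2p))/((1-gp)·ln g). -/
theorem stmt10 (p : ℝ) (hp0 : 0 < p) (hp1 : p ≤ p₀)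
    (gs : ℝ) (hgs : gs ∈ Set.Ico (2 : ℝ) 4) (hroot : hfun p gs = 0) :
    frand p gs = gs * ((1 - p) / (1 - gs * p)) ^ 2 + 1 ∧
    ∀ g : ℝ, 2 ≤ g → g < 1 / p →
      frand p g ≥ gs * ((1 - p) / (1 - gs * p)) ^ 2 + 1 := by
  obtain ⟨h2, h4⟩ := hgs
  have hL : (0.6931471803 : ℝ) < Real.log 2 := Real.log_two_gt_d9
  have hp4 : p < 1 / 4 := by
    have hs : 3 - Real.log 2 < Real.sqrt (1 + (Real.log 2) ^ 2 + 6 * Real.log 2) := by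
      apply Real.lt_sqrt_of_sq_lt
      nlinarith
    unfold p₀ at hp1
    linarith
  have hv : 0 < 1 - gs * p := by nlinarith
  have hls : 0 < Real.log gs := Real.log_pos (by linarith)
  unfold hfun at hroot
  refine ⟨?_, ?_⟩
  · unfold frand
    have hne := hv.ne'
    have hne2 := hls.ne'
    have key : (1 - p) * (1 + gs * (1 - 2 * p)) / ((1 - gs * p) * Real.log gs)
        = gs * ((1 - p) / (1 - gs * p)) ^ 2 := by
      rw [div_pow, ← mul_div_assoc, div_eq_div_iff (mul_ne_zero hne hne2) (pow_ne_zero 2 hne)]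
      linear_combination (1 - p) * (1 - gs * p) * hroot
    rw [key]; ring
  · intro g hg hgp
    have hu : 0 < 1 - g * p := by
      rw [lt_div_iff₀ hp0] at hgp
      linarith
    have hl : 0 < Real.log g := Real.log_pos (by linarith)
    have hgs0 : 0 < gs := by linarith
    have hlog : gs * Real.log g ≤ gs * Real.log gs + (g - gs) := by
      have h := Real.log_le_sub_one_of_pos (div_pos (by linarith : 0 < g) hgs0)
      rw [Real.log_div (by linarith) (by linarith)] at h
      have h' := mul_le_mul_of_nonneg_left h hgs0.le
      have e : gs * (g / gs - 1) = g - gs := by field_simp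
      rw [e] at h'
      linarith
    have hq : 0 < 1 - p := by linarith
    unfold frand
    have key : gs * ((1 - p) / (1 - gs * p)) ^ 2 ≤
        (1 - p) * (1 + g * (1 - 2 * p)) / ((1 - g * p) * Real.log g) := by
      rw [div_pow, ← mul_div_assoc, div_le_div_iff₀ (pow_pos hv 2) (mul_pos hu hl)]
      have h1 := mul_le_mul_of_nonneg_left hlog (mul_pos (pow_pos hq 2) hu).le
      have h3 : 0 ≤ (1 - p) * ((1 - p) * p * (g - gs) ^ 2) := by positivity
      have h5 : (1 - p) * (1 - g * p) * ((1 - gs * p) * (1 + gs * (1 - 2 * p)) - gs * (1 - p) * Real.log gs) = 0 := by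
        rw [hroot, mul_zero]
      nlinarith
    linarith
end

section
/- Let p_0 := (5 - √(1 + (ln 2)² + 6·ln 2) - ln 2)/8 and h_p(g) := (1-gp)(1 + g(1-2p)) - g(1-p)·ln g. For every p in (0, p_0], if g* ∈ [2, 4) satisfies h_p(g*) = 0, then g* < 1/(2p); in particular g* < 1/p. -/
theorem stmt11 (p : ℝ) (hp0 : 0 < p) (hp1 : p ≤ p₀)
    (gs : ℝ) (hgs : gs ∈ Set.Ico (2 : ℝ) 4) (hroot : hfun p gs = 0) :
    gs < 1 / (2 * p) ∧ gs < 1 / p := by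
  have hL := Real.log_two_gt_d9
  obtain ⟨h2, h4⟩ := hgs
  have hs : 3 - Real.log 2 ≤ Real.sqrt (1 + (Real.log 2) ^ 2 + 6 * Real.log 2) := by
    apply Real.le_sqrt_of_sq_le
    nlinarith
  have hp4 : p ≤ 1 / 4 := by
    unfold p₀ at hp1
    linarith
  have key : gs < 1 / (2 * p) := by
    by_contra hc
    have hc := not_lt.mp hc
    rw [div_le_iff₀ (by positivity)] at hc
    have hlog : Real.log 2 ≤ Real.log gs := Real.log_le_log (by norm_num) h2
    have h1 : gs * p < 1 := by nlinarith
    have hA : (1 - gs * p) * (1 + gs * (1 - 2 * p)) ≤ gs / 2 := by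
      nlinarith [mul_nonneg (by linarith : (0:ℝ) ≤ gs * p - 1 / 2) (by linarith : (0:ℝ) ≤ 1 - gs * p),
        mul_nonneg (by linarith : (0:ℝ) ≤ gs * p - 1 / 2) (by linarith : (0:ℝ) ≤ gs)]
    have hB : 1 / 2 < (1 - p) * Real.log gs := by nlinarith
    have hC : gs * (1 / 2) < gs * ((1 - p) * Real.log gs) :=
      mul_lt_mul_of_pos_left hB (by linarith)
    unfold hfun at hroot
    linarith
  refine ⟨key, key.trans_le ?_⟩
  apply one_div_le_one_div_of_le hp0
  linarith
end

section
/- For every p in (0, 1/2), the inequality 1 + (1-p)(3-4p)/((1-2p)·ln 2) ≤ 9 holds if and only if p ≤ (7 + √(1 + 256·(ln 2)² - 96·ln 2) - 16·ln 2)/8. -/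
theorem stmt12 (p : ℝ) (hp0 : 0 < p) (hp1 : p < 1 / 2) :
    1 + (1 - p) * (3 - 4 * p) / ((1 - 2 * p) * Real.log 2) ≤ 9 ↔
      p ≤ (7 + Real.sqrt (1 + 256 * (Real.log 2) ^ 2 - 96 * Real.log 2)
            - 16 * Real.log 2) / 8 := by
  have hL := Real.log_two_gt_d9
  generalize Real.log 2 = L at *
  have hd : 0 < (1 - 2 * p) * L := mul_pos (by linarith) (by linarith)
  have h1 : 1 + (1 - p) * (3 - 4 * p) / ((1 - 2 * p) * L) ≤ 9 ↔
      (1 - p) * (3 - 4 * p) ≤ 8 * ((1 - 2 * p) * L) := by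
    rw [← div_le_iff₀ hd]
    constructor <;> intro h <;> linarith
  have h2 : p ≤ (7 + Real.sqrt (1 + 256 * L ^ 2 - 96 * L) - 16 * L) / 8 ↔
      8 * p + 16 * L - 7 ≤ Real.sqrt (1 + 256 * L ^ 2 - 96 * L) := by
    constructor <;> intro h <;> linarith
  rw [h1, h2, Real.le_sqrt' (by linarith)]
  constructor <;> intro h <;> nlinarith
end

section
/- Fix a real p and a natural number t ≥ 0, and let P be the (t+1)×(t+1) real matrix with entries P_{i,j} = -(1-p)·p^{j-i-1} if j > i and P_{i,j} = 0 otherwise (indices 1 ≤ i, j ≤ t+1). Define δ_1 = 1 and δ_m = ((1-p)/2)·(1 - (2p-1)^{m-2}) for m ≥ 2, and let B be the (t+1)×(t+1) matrix with B_{i,j} = δ_{j-i+1} if j ≥ i and B_{i,j} = 0 if i > j. Then B·(I - P²) = I and (I - P²)·B = I; that is, I - P² is invertible with inverse B. -/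
open PowerSeries in
noncomputable def toepl (t : ℕ) (f : PowerSeries ℝ) : Matrix (Fin (t + 1)) (Fin (t + 1)) ℝ :=
  fun i j => if (i : ℕ) ≤ (j : ℕ) then PowerSeries.coeff ((j : ℕ) - (i : ℕ)) f else 0

theorem toepl_one (t : ℕ) : toepl t 1 = 1 := by
  ext i j
  simp only [toepl, PowerSeries.coeff_one, Matrix.one_apply, Fin.ext_iff]
  split_ifs <;> first | rfl | omega

theorem toepl_sub (t : ℕ) (f g : PowerSeries ℝ) :
    toepl t (f - g) = toepl t f - toepl t g := by
  ext i j
  simp only [toepl, map_sub, Matrix.sub_apply]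
  split_ifs <;> simp

theorem toepl_mul (t : ℕ) (f g : PowerSeries ℝ) :
    toepl t (f * g) = toepl t f * toepl t g := by
  ext i j
  rw [Matrix.mul_apply]
  simp only [toepl]
  rw [Fin.sum_univ_eq_sum_range (fun k => (if (i : ℕ) ≤ k then PowerSeries.coeff (k - (i : ℕ)) f else 0) *
    (if k ≤ (j : ℕ) then PowerSeries.coeff ((j : ℕ) - k) g else 0)) (t + 1)]
  split_ifs with h
  · rw [PowerSeries.coeff_mul, Finset.Nat.sum_antidiagonal_eq_sum_range_succ
      (fun a b => PowerSeries.coeff a f * PowerSeries.coeff b g)]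
    have hj := j.isLt
    apply Finset.sum_of_injOn (fun a => a + (i : ℕ))
    · intro a _ b _ hab
      simpa using hab
    · intro a ha
      simp only [Finset.coe_range, Set.mem_Iio] at *
      omega
    · intro k hk hk'
      by_cases h1 : (i : ℕ) ≤ k
      · by_cases h2 : k ≤ (j : ℕ)
        · exact absurd ⟨k - i, by simp; omega, by simp; omega⟩ hk'
        · simp [h2]
      · simp [h1]
    · intro a ha
      simp only [Finset.mem_range] at ha
      rw [if_pos (by omega), if_pos (by omega)]
      congr 3 <;> omega
  · symm
    apply Finset.sum_eq_zero
    intro k _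
    by_cases h1 : (i : ℕ) ≤ k
    · rw [if_neg (show ¬ k ≤ (j : ℕ) by omega), mul_zero]
    · rw [if_neg h1, zero_mul]

theorem series_key (p : ℝ) (δ : ℕ → ℝ) (hδ1 : δ 1 = 1)
    (hδ : ∀ m : ℕ, 2 ≤ m → δ m = ((1 - p) / 2) * (1 - (2 * p - 1) ^ (m - 2))) :
    (PowerSeries.mk fun n => δ (n + 1)) *
      (1 - (PowerSeries.mk fun n => if 0 < n then -(1 - p) * p ^ (n - 1) else 0) *
        (PowerSeries.mk fun n => if 0 < n then -(1 - p) * p ^ (n - 1) else 0)) = 1 := by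
  set q : PowerSeries ℝ := PowerSeries.mk fun n => if 0 < n then -(1 - p) * p ^ (n - 1) else 0 with hq
  set b : PowerSeries ℝ := PowerSeries.mk fun n => δ (n + 1) with hb
  have h1 : (1 - PowerSeries.C p * PowerSeries.X) * q = - (1 - PowerSeries.C p) * PowerSeries.X := by
    have e : - (1 - PowerSeries.C p) = PowerSeries.C (-(1 - p)) := by simp
    rw [e, sub_mul, one_mul, mul_assoc]
    ext n
    rw [map_sub, PowerSeries.coeff_C_mul, PowerSeries.coeff_C_mul]
    rcases n with _ | _ | n
    · simp [hq]
    · simp [hq, PowerSeries.coeff_succ_X_mul, PowerSeries.coeff_X]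
    · simp [hq, PowerSeries.coeff_succ_X_mul, PowerSeries.coeff_X]
      ring
  have h2 : (1 - PowerSeries.X) * ((1 - PowerSeries.C (2 * p - 1) * PowerSeries.X) * b)
      = (1 - PowerSeries.C p * PowerSeries.X) ^ 2 := by
    have e : (1 - PowerSeries.X) * ((1 - PowerSeries.C (2 * p - 1) * PowerSeries.X) * b)
      = b - PowerSeries.C (2 * p) * (PowerSeries.X * b)
        + PowerSeries.C (2 * p - 1) * (PowerSeries.X * (PowerSeries.X * b)) := by
      simp only [map_sub, map_one]; ring
    have e' : (1 - PowerSeries.C p * PowerSeries.X) ^ 2 = 1 - PowerSeries.C (2 * p) * PowerSeries.X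
       + PowerSeries.C (p ^ 2) * (PowerSeries.X * (PowerSeries.X * 1)) := by
      simp only [map_mul, map_pow, map_ofNat]; ring
    rw [e, e']
    ext n
    simp only [map_sub (PowerSeries.coeff n), map_add (PowerSeries.coeff n), PowerSeries.coeff_C_mul]
    have d2 := hδ 2 le_rfl
    have d3 := hδ 3 (by norm_num)
    rcases n with _ | _ | _ | n
    · simp [hb, hδ1]
    · simp [hb, hδ1, d2, PowerSeries.coeff_succ_X_mul, PowerSeries.coeff_X, PowerSeries.coeff_one]
    · simp [hb, hδ1, d2, d3, PowerSeries.coeff_succ_X_mul, PowerSeries.coeff_X, PowerSeries.coeff_one]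
      ring
    · have a4 := hδ (n + 4) (by omega)
      have a3 := hδ (n + 3) (by omega)
      have a2 := hδ (n + 2) (by omega)
      simp only [show n + 4 - 2 = n + 2 by omega, show n + 3 - 2 = n + 1 by omega,
        show n + 2 - 2 = n by omega] at a4 a3 a2
      simp [hb, PowerSeries.coeff_succ_X_mul, PowerSeries.coeff_X, PowerSeries.coeff_one, add_assoc, a4, a3, a2]
      ring
  have hne : (1 - PowerSeries.C p * PowerSeries.X : PowerSeries ℝ) ^ 2 ≠ 0 := by
    apply pow_ne_zero
    intro h
    have := congrArg (PowerSeries.coeff 0) h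
    simp at this
  apply mul_left_cancel₀ hne
  have e3 : (PowerSeries.C (2 * p - 1) : PowerSeries ℝ) = 2 * PowerSeries.C p - 1 := by
    rw [map_sub, map_mul, map_one, map_ofNat]
  rw [e3] at h2
  generalize PowerSeries.C p = c at *
  generalize (PowerSeries.X : PowerSeries ℝ) = x at *
  linear_combination h2 - b * ((1 - c * x) * q - (1 - c) * x) * h1

theorem stmt17 (p : ℝ) (t : ℕ)
    (P : Matrix (Fin (t + 1)) (Fin (t + 1)) ℝ)
    (hP : ∀ i j : Fin (t + 1),
      P i j = if (i : ℕ) < (j : ℕ) then -(1 - p) * p ^ ((j : ℕ) - (i : ℕ) - 1) else 0)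
    (δ : ℕ → ℝ) (hδ1 : δ 1 = 1)
    (hδ : ∀ m : ℕ, 2 ≤ m → δ m = ((1 - p) / 2) * (1 - (2 * p - 1) ^ (m - 2)))
    (B : Matrix (Fin (t + 1)) (Fin (t + 1)) ℝ)
    (hB : ∀ i j : Fin (t + 1),
      B i j = if (i : ℕ) ≤ (j : ℕ) then δ ((j : ℕ) - (i : ℕ) + 1) else 0) :
    B * (1 - P ^ 2) = 1 ∧ (1 - P ^ 2) * B = 1 := by

  have eP : P = toepl t (PowerSeries.mk fun n => if 0 < n then -(1 - p) * p ^ (n - 1) else 0) := by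
    ext i j
    rw [hP]
    simp only [toepl, PowerSeries.coeff_mk]
    split_ifs <;> first | rfl | omega
  have eB : B = toepl t (PowerSeries.mk fun n => δ (n + 1)) := by
    ext i j
    rw [hB]
    simp only [toepl, PowerSeries.coeff_mk]
  have key := series_key p δ hδ1 hδ
  have h : B * (1 - P ^ 2) = 1 := by
    rw [eP, eB, pow_two, ← toepl_mul, ← toepl_one, ← toepl_sub, ← toepl_mul, key]
  exact ⟨h, mul_eq_one_comm.mp h⟩
end

section
/- For every p in (0, 1/2), let s := (1 - 2·√(p - p²))/(1 - 2p). Then 0 < s < 1 and (5 - s·(s + 4 - 8p))/(1 - s²) = 3 + 4·√(p(1-p)). -/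
theorem stmt18 (p : ℝ) (hp0 : 0 < p) (hp1 : p < 1 / 2) :
    0 < (1 - 2 * Real.sqrt (p - p ^ 2)) / (1 - 2 * p) ∧
    (1 - 2 * Real.sqrt (p - p ^ 2)) / (1 - 2 * p) < 1 ∧
    (5 - (1 - 2 * Real.sqrt (p - p ^ 2)) / (1 - 2 * p) *
        ((1 - 2 * Real.sqrt (p - p ^ 2)) / (1 - 2 * p) + 4 - 8 * p)) /
      (1 - ((1 - 2 * Real.sqrt (p - p ^ 2)) / (1 - 2 * p)) ^ 2) =
      3 + 4 * Real.sqrt (p * (1 - p)) := by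
  have e : p * (1 - p) = p - p ^ 2 := by ring
  rw [e]
  have hpos : 0 < p - p ^ 2 := by nlinarith
  have hr := Real.sqrt_pos.mpr hpos
  have hr2 := Real.sq_sqrt hpos.le
  generalize Real.sqrt (p - p ^ 2) = r at hr hr2
  have hd : 0 < 1 - 2 * p := by linarith
  have hrh : r < 1 / 2 := by nlinarith [mul_pos hd hd]
  have hpr : p < r := by nlinarith [mul_pos hp0 hd]
  obtain ⟨s, hs⟩ : ∃ s, s = (1 - 2 * r) / (1 - 2 * p) := ⟨_, rfl⟩
  rw [← hs]
  have h1 : s * (1 - 2 * p) = 1 - 2 * r := by rw [hs]; field_simp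
  have hs0 : 0 < s := by rw [hs]; exact div_pos (by linarith) hd
  have hs1 : s < 1 := by rw [hs, div_lt_one hd]; linarith
  refine ⟨hs0, hs1, ?_⟩
  have h2 : s ^ 2 * (1 + 2 * r) = 1 - 2 * r := by
    have h3 : (1 - 2 * r) * (s ^ 2 * (1 + 2 * r)) = (1 - 2 * r) * (1 - 2 * r) := by
      have h4 : (1 - 2 * p) ^ 2 = (1 - 2 * r) * (1 + 2 * r) := by linear_combination 4 * hr2
      calc _ = s ^ 2 * ((1 - 2 * r) * (1 + 2 * r)) := by ring
        _ = (s * (1 - 2 * p)) ^ 2 := by rw [← h4]; ring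
        _ = _ := by rw [h1]; ring
    exact mul_left_cancel₀ (by linarith) h3
  have h5 : 1 - s ^ 2 ≠ 0 := by nlinarith
  rw [div_eq_iff h5]
  linear_combination (-4) * h1 + 2 * h2
end

section
/- For every p in [0, 1/2) and every s in the open interval (0, 1), one has (5 - s·(s + 4 - 8p))/(1 - s²) ≥ 3 + 4·√(p(1-p)). -/
theorem stmt19 (p : ℝ) (hp0 : 0 ≤ p) (hp1 : p < 1 / 2)
    (s : ℝ) (hs0 : 0 < s) (hs1 : s < 1) :
    (5 - s * (s + 4 - 8 * p)) / (1 - s ^ 2) ≥ 3 + 4 * Real.sqrt (p * (1 - p)) := by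
  have hd : 0 < 1 - s ^ 2 := by nlinarith
  rw [ge_iff_le, le_div_iff₀ hd, Real.sqrt_mul hp0]
  have ha := Real.sq_sqrt hp0
  have hb := Real.sq_sqrt (show (0:ℝ) ≤ 1 - p by linarith)
  set a := Real.sqrt p
  set b := Real.sqrt (1 - p)
  have h := sq_nonneg (b * (1 - s) - a * (1 + s))
  have e : (b * (1 - s) - a * (1 + s)) ^ 2
      = (1 - p) * (1 - s) ^ 2 + p * (1 + s) ^ 2 - 2 * (a * b) * (1 - s ^ 2) := by
    rw [← hb, ← ha]; ring
  rw [e] at h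
  linarith
end
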